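/- Let G be a minimal counterexample. If S is a proper subset of V(G) with |S| + |E(G[S])| ≥ 5, where G[S] is the induced subgraph on S, then ρ_G(S) ≥ 3. -/

import Mathlib

open SimpleGraph

noncomputable def edgeCount {V : Type*} (G : SimpleGraph V) : ℕ := Nat.card G.edgeSet

noncomputable def deg {V : Type*} (G : SimpleGraph V) (v : V) : ℕ := Nat.card (G.neighborSet v)

def TwoIndependent {V : Type*} (G : SimpleGraph V) (S : Set V) : Prop :=
  ∀ u ∈ S, ∀ v ∈ S, u ≠ v → ¬ G.Adj u v ∧ ∀ w, ¬ (G.Adj u w ∧ G.Adj w v)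

def IsIFPartition {V : Type*} (G : SimpleGraph V) (A B : Set V) : Prop :=
  A ∪ B = Set.univ ∧ Disjoint A B ∧ TwoIndependent G A ∧ (G.induce B).IsAcyclic

def IsAssignment {V : Type*} (I F U : Set V) : Prop :=
  I ∪ F ∪ U = Set.univ ∧ Disjoint I F ∧ Disjoint I U ∧ Disjoint F U

noncomputable def rho {V : Type*} (G : SimpleGraph V) (I F U : Set V) (H : G.Subgraph) : ℤ :=
  (H.verts ∩ I).ncard + 4 * (H.verts ∩ F).ncard + 5 * (H.verts ∩ U).ncard
    - 4 * Nat.card H.edgeSet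

noncomputable def rhoSet {V : Type*} (G : SimpleGraph V) (I F U : Set V) (S : Set V) : ℤ :=
  (S ∩ I).ncard + 4 * (S ∩ F).ncard + 5 * (S ∩ U).ncard - 4 * edgeCount (G.induce S)

def IsCounterexample {V : Type*} [Fintype V] (G : SimpleGraph V) (I F U : Set V) : Prop :=
  IsAssignment I F U ∧
  (∀ H : G.Subgraph, H.verts.Nonempty → 0 < rho G I F U H) ∧
  ¬ ∃ A B : Set V, IsIFPartition G A B ∧ I ⊆ A ∧ F ⊆ B

def IsMinCounterexample {V : Type*} [Fintype V] (G : SimpleGraph V) (I F U : Set V) : Prop :=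
  IsCounterexample G I F U ∧
  ∀ (n : ℕ) (G' : SimpleGraph (Fin n)) (I' F' U' : Set (Fin n)),
    IsCounterexample G' I' F' U' →
    Fintype.card V + edgeCount G ≤ n + edgeCount G'

def IsThread {V : Type*} (G : SimpleGraph V) (I F U : Set V) (p : List V) : Prop :=
  p ≠ [] ∧ p.Nodup ∧ p.Chain' G.Adj ∧ (∀ v ∈ p, v ∈ U ∧ deg G v = 2) ∧
  (∀ w, w ∉ p → (∃ a ∈ p, G.Adj a w) → 3 ≤ deg G w ∨ w ∈ I ∪ F)

def BordersThread {V : Type*} (G : SimpleGraph V) (p : List V) (w : V) : Prop :=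
  w ∉ p ∧ ∃ a ∈ p, G.Adj a w

def IsStarForest {V : Type*} (H : SimpleGraph V) : Prop :=
  H.IsAcyclic ∧ ∀ a b c d : V, H.Adj a b → H.Adj b c → H.Adj c d → a = c ∨ b = d

def IsStarColoring {V : Type*} {k : ℕ} (G : SimpleGraph V) (c : V → Fin k) : Prop :=
  (∀ u v, G.Adj u v → c u ≠ c v) ∧
  ∀ i j : Fin k, IsStarForest (G.induce {v | c v = i ∨ c v = j})

def StarColorable {V : Type*} (G : SimpleGraph V) (k : ℕ) : Prop :=
  ∃ c : V → Fin k, IsStarColoring G c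

def MadLt {V : Type*} (G : SimpleGraph V) (q : ℚ) : Prop :=
  ∀ H : G.Subgraph, H.verts.Nonempty →
    (2 * (Nat.card H.edgeSet : ℚ)) / (H.verts.ncard : ℚ) < q

open Classical in
/-- Adjacency indicator. -/
noncomputable def ad {V : Type*} (G : SimpleGraph V) (u v : V) : ℤ :=
  if G.Adj u v then 1 else 0

/-- Number of ordered pairs `(u, v) ∈ A × B` which are adjacent. -/
noncomputable def xe {V : Type*} (G : SimpleGraph V) (A B : Finset V) : ℤ :=
  ∑ u ∈ A, ∑ v ∈ B, ad G u v

open Classical in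
noncomputable def wt {V : Type*} (I F : Set V) (v : V) : ℤ :=
  if v ∈ I then 1 else if v ∈ F then 4 else 5

/-- Twice the potential. -/
noncomputable def pot {V : Type*} (G : SimpleGraph V) (I F : Set V) (T : Finset V) : ℤ :=
  2 * ∑ v ∈ T, wt I F v - 4 * xe G T T

section basics
variable {V : Type*} (G : SimpleGraph V)

lemma ad_one {u v : V} (h : G.Adj u v) : ad G u v = 1 := by simp [ad, h]

lemma ad_zero {u v : V} (h : ¬ G.Adj u v) : ad G u v = 0 := by simp [ad, h]

lemma ad_nonneg (u v : V) : 0 ≤ ad G u v := by unfold ad; split_ifs <;> simp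

lemma ad_comm (u v : V) : ad G u v = ad G v u := by
  by_cases h : G.Adj u v
  · rw [ad_one G h, ad_one G h.symm]
  · rw [ad_zero G h, ad_zero G fun h' => h h'.symm]

lemma ad_le {W : Type*} (H : SimpleGraph W) {u v : V} {a b : W} (h : G.Adj u v → H.Adj a b) :
    ad G u v ≤ ad H a b := by
  by_cases huv : G.Adj u v
  · rw [ad_one G huv, ad_one H (h huv)]
  · rw [ad_zero G huv]; exact ad_nonneg H a b

lemma ad_congr {W : Type*} (H : SimpleGraph W) {u v : V} {a b : W} (h : G.Adj u v ↔ H.Adj a b) :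
    ad G u v = ad H a b :=
  le_antisymm (ad_le G H h.1) (ad_le H G h.2)

lemma xe_nonneg (A B : Finset V) : 0 ≤ xe G A B :=
  Finset.sum_nonneg fun _ _ => Finset.sum_nonneg fun _ _ => ad_nonneg G _ _

lemma xe_comm (A B : Finset V) : xe G A B = xe G B A := by
  unfold xe
  rw [Finset.sum_comm]
  exact Finset.sum_congr rfl fun _ _ => Finset.sum_congr rfl fun _ _ => ad_comm G _ _

lemma xe_union_left [DecidableEq V] {A B : Finset V} (C : Finset V) (h : Disjoint A B) :
    xe G (A ∪ B) C = xe G A C + xe G B C := by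
  unfold xe
  exact Finset.sum_union h

lemma xe_union_right [DecidableEq V] {A B : Finset V} (C : Finset V) (h : Disjoint A B) :
    xe G C (A ∪ B) = xe G C A + xe G C B := by
  rw [xe_comm, xe_union_left G C h, xe_comm G A, xe_comm G B]

lemma xe_union_self [DecidableEq V] {A B : Finset V} (h : Disjoint A B) :
    xe G (A ∪ B) (A ∪ B) = xe G A A + xe G B B + 2 * xe G A B := by
  rw [xe_union_left G _ h, xe_union_right G _ h, xe_union_right G _ h, xe_comm G B A]
  ring

lemma xe_mono_left {A A' B : Finset V} (h : A ⊆ A') : xe G A B ≤ xe G A' B :=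
  Finset.sum_le_sum_of_subset_of_nonneg h
    fun _ _ _ => Finset.sum_nonneg fun _ _ => ad_nonneg G _ _

lemma xe_mono_right {A B B' : Finset V} (h : B ⊆ B') : xe G A B ≤ xe G A B' := by
  rw [xe_comm G A, xe_comm G A]; exact xe_mono_left G h

lemma xe_pos {A B : Finset V} {a b : V} (ha : a ∈ A) (hb : b ∈ B) (h : G.Adj a b) :
    1 ≤ xe G A B := by
  have h1 : xe G {a} {b} = 1 := by simp [xe, ad_one G h]
  rw [← h1]
  exact (xe_mono_left G (by simpa using ha)).trans (xe_mono_right G (by simpa using hb))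

lemma xe_eq_zero {A B : Finset V} (h : ∀ a ∈ A, ∀ b ∈ B, ¬ G.Adj a b) : xe G A B = 0 :=
  Finset.sum_eq_zero fun a ha => Finset.sum_eq_zero fun b hb => ad_zero G (h a ha b hb)

lemma pot_union [DecidableEq V] (I F : Set V) {A B : Finset V} (h : Disjoint A B) :
    pot G I F (A ∪ B) = pot G I F A + pot G I F B - 8 * xe G A B := by
  unfold pot
  rw [xe_union_self G h, Finset.sum_union h]; ring

lemma xe_univ [Fintype V] : (xe G Finset.univ Finset.univ) = 2 * (Nat.card G.edgeSet : ℤ) := by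
  classical
  have h := G.sum_degrees_eq_twice_card_edges
  have h2 : Nat.card G.edgeSet = G.edgeFinset.card := by
    rw [Nat.card_eq_fintype_card, edgeFinset_card]
  rw [h2]
  have : (∑ v, (G.degree v : ℤ)) = 2 * (G.edgeFinset.card : ℤ) := by exact_mod_cast h
  rw [← this]
  unfold xe
  refine Finset.sum_congr rfl fun v _ => ?_
  rw [← card_neighborFinset_eq_degree, neighborFinset_eq_filter]
  simp [ad]

/-- `xe` for a map along an embedding. -/
lemma xe_map {W : Type*} (H : SimpleGraph W) (f : W ↪ V) (h : ∀ a b, H.Adj a b ↔ G.Adj (f a) (f b))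
    (A B : Finset W) : xe H A B = xe G (A.map f) (B.map f) := by
  simp only [xe, Finset.sum_map]
  exact Finset.sum_congr rfl fun _ _ => Finset.sum_congr rfl fun _ _ => ad_congr H G (h _ _)

lemma pot_map {W : Type*} (H : SimpleGraph W) (f : W ↪ V) (h : ∀ a b, H.Adj a b ↔ G.Adj (f a) (f b))
    (I F : Set V) (A : Finset W) :
    pot H (f ⁻¹' I) (f ⁻¹' F) A = pot G I F (A.map f) := by
  simp only [pot, xe_map G H f h, Finset.sum_map]
  congr

lemma edgeCount_induce [Fintype V] (T : Finset V) :
    2 * (edgeCount (G.induce (T : Set V)) : ℤ) = xe G T T := by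
  classical
  unfold edgeCount
  rw [← xe_univ, xe_map G (G.induce (T : Set V)) (Function.Embedding.subtype _) (by simp)]
  congr 1 <;> ext <;> simp

lemma sum_wt (I F U : Set V) [Fintype V] (h : IsAssignment I F U) (T : Finset V) :
    ∑ v ∈ T, wt I F v = (((T : Set V) ∩ I).ncard + 4 * ((T : Set V) ∩ F).ncard +
      5 * ((T : Set V) ∩ U).ncard : ℤ) := by
  classical
  obtain ⟨h1, h2, h3, h4⟩ := h
  have key : ∀ X : Set V, (((T : Set V) ∩ X).ncard : ℤ) = ∑ v ∈ T, if v ∈ X then 1 else 0 := by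
    intro X
    have : (T : Set V) ∩ X = (T.filter (· ∈ X) : Finset V) := by ext; simp
    rw [this, Set.ncard_coe_finset]
    simp
  rw [key, key, key, Finset.mul_sum, Finset.mul_sum, ← Finset.sum_add_distrib,
    ← Finset.sum_add_distrib]
  refine Finset.sum_congr rfl fun v _ => ?_
  have hv : v ∈ I ∪ F ∪ U := by rw [h1]; trivial
  have a2 : v ∈ I → v ∉ F := fun hv => Set.disjoint_left.1 h2 hv
  have a3 : v ∈ I → v ∉ U := fun hv => Set.disjoint_left.1 h3 hv
  have a4 : v ∈ F → v ∉ U := fun hv => Set.disjoint_left.1 h4 hv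
  unfold wt
  rcases hv with (hv | hv) | hv
  · simp [hv, a2 hv, a3 hv]
  · simp [hv, a4 hv, show v ∉ I from fun h => a2 h hv]
  · simp [hv, show v ∉ I from fun h => a3 h hv, show v ∉ F from fun h => a4 h hv]

lemma rhoSet_eq (I F U : Set V) [Fintype V] (h : IsAssignment I F U) (T : Finset V) :
    2 * rhoSet G I F U T = pot G I F T := by
  unfold rhoSet pot
  rw [sum_wt I F U h, ← edgeCount_induce]
  ring

lemma rho_le (I F U : Set V) [Fintype V] (h : IsAssignment I F U) (T : Finset V)
    (H : G.Subgraph) (hH : H.verts = T) :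
    pot G I F T ≤ 2 * rho G I F U H := by
  classical
  unfold rho pot
  rw [sum_wt I F U h, hH, ← Subgraph.edgeSet_spanningCoe]
  have h1 := xe_univ H.spanningCoe
  have h2 : xe H.spanningCoe Finset.univ Finset.univ ≤ xe G T T := by
    have : xe H.spanningCoe Finset.univ Finset.univ = xe H.spanningCoe T T := by
      symm
      unfold xe
      have hz : ∀ u v, H.Adj u v → u ∈ T ∧ v ∈ T := fun u v huv => by
        have a := H.edge_vert huv
        have b := H.edge_vert huv.symm
        rw [hH] at a b
        exact ⟨a, b⟩
      rw [Finset.sum_subset (Finset.subset_univ T)]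
      · refine Finset.sum_congr rfl fun u _ => ?_
        refine Finset.sum_subset (Finset.subset_univ T) fun v _ hv => ?_
        exact ad_zero _ fun h => hv (hz _ _ h).2
      · intro u _ hu
        refine Finset.sum_eq_zero fun v _ => ?_
        exact ad_zero _ fun h => hu (hz _ _ h).1
    rw [this]
    refine Finset.sum_le_sum fun u _ => Finset.sum_le_sum fun v _ => ?_
    exact ad_le _ _ fun h => H.adj_sub h
  linarith

lemma rho_induce (I F U : Set V) [Fintype V] (h : IsAssignment I F U) (T : Finset V) :
    2 * rho G I F U ((⊤ : G.Subgraph).induce T) ≤ pot G I F T := by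
  classical
  unfold rho pot
  rw [sum_wt I F U h, ← Subgraph.edgeSet_spanningCoe]
  have h1 := xe_univ ((⊤ : G.Subgraph).induce T).spanningCoe
  have h2 : xe G T T ≤ xe ((⊤ : G.Subgraph).induce T).spanningCoe Finset.univ Finset.univ := by
    refine le_trans ?_ ((xe_mono_left _ (Finset.subset_univ T)).trans
      (xe_mono_right _ (Finset.subset_univ T)))
    refine Finset.sum_le_sum fun u hu => Finset.sum_le_sum fun v hv => ?_
    exact ad_le _ _ fun h => by simpa [hu, hv] using h
  simp only [Subgraph.induce_verts]
  linarith

lemma acyclic_count [Fintype V] [Nonempty V] (h : G.IsAcyclic) :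
    xe G Finset.univ Finset.univ < 2 * (Fintype.card V : ℤ) := by
  classical
  obtain ⟨H, hGH, hH⟩ := Set.Finite.exists_le_maximal
    (Set.toFinite {H : SimpleGraph V | H.IsAcyclic}) (a := G) h
  have hT : H.IsTree := by
    rw [isTree_iff_maximal_isAcyclic]
    exact ⟨inferInstance, hH⟩
  have h1 := hT.card_edgeFinset
  have h2 : xe G Finset.univ Finset.univ ≤ xe H Finset.univ Finset.univ := by
    refine Finset.sum_le_sum fun u hu => Finset.sum_le_sum fun v hv => ?_
    exact ad_le _ _ fun h => hGH h
  rw [xe_univ H, Nat.card_eq_fintype_card, ← edgeFinset_card] at h2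
  omega

lemma acyclic_iff_count [Fintype V] (B : Set V) : (G.induce B).IsAcyclic ↔
    ∀ T : Finset V, T.Nonempty → (T : Set V) ⊆ B → xe G T T < 2 * (T.card : ℤ) := by
  classical
  constructor
  · intro h T hT hTB
    have hac : (G.induce (T : Set V)).IsAcyclic :=
      h.embedding (SimpleGraph.induceHomOfLE G hTB)
    have : Nonempty (T : Set V) := by
      obtain ⟨x, hx⟩ := hT
      exact ⟨⟨x, hx⟩⟩
    have := acyclic_count _ hac
    rw [xe_univ] at this
    have h2 := edgeCount_induce G T
    unfold edgeCount at h2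
    rw [h2] at this
    simpa using this
  · intro h v p hp
    let T : Finset V := p.support.toFinset.map (Function.Embedding.subtype _)
    have hc := h T ⟨v, by simp [T]⟩ (by
      intro x hx
      simp only [Finset.coe_map, Function.Embedding.subtype_apply, Set.mem_image, T] at hx
      obtain ⟨y, _, rfl⟩ := hx
      exact y.2)
    simp only [T] at hc
    rw [← xe_map G (G.induce B) (Function.Embedding.subtype _) (by simp)] at hc
    rw [Finset.card_map] at hc
    have : ∑ u ∈ p.support.toFinset, (2 : ℤ) ≤
        xe (G.induce B) p.support.toFinset p.support.toFinset := by
      refine Finset.sum_le_sum fun u hu => ?_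
      have hu' : u ∈ p.support := by simpa using hu
      have h2 := hp.ncard_neighborSet_toSubgraph_eq_two hu'
      have h3 : (p.toSubgraph.neighborSet u) ⊆
          ((p.support.toFinset.filter (fun w => (G.induce B).Adj u w) : Finset _) : Set _) := by
        intro w hw
        have hw' : p.toSubgraph.Adj u w := hw
        have a := hw'.snd_mem
        have b := hw'.adj_sub
        simp only [Walk.verts_toSubgraph] at a
        simp only [Finset.coe_filter, List.mem_toFinset]
        exact ⟨a, b⟩
      have h4 := Set.ncard_le_ncard h3 (Finset.finite_toSet _)
      rw [h2, Set.ncard_coe_finset] at h4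
      have h5 : ((p.support.toFinset.filter (fun w => (G.induce B).Adj u w)).card : ℤ) =
          ∑ w ∈ p.support.toFinset, ad (G.induce B) u w := by
        rw [Finset.card_filter]
        push_cast
        refine Finset.sum_congr rfl fun w _ => ?_
        by_cases hw : (G.induce B).Adj u w
        · rw [ad_one _ hw, if_pos hw]
        · rw [ad_zero _ hw, if_neg hw]
      rw [← h5]
      exact_mod_cast h4
    rw [Finset.sum_const] at this
    simp only [nsmul_eq_mul] at this
    linarith

end basics

/-- Working form of the existence of an I,F-partition extending the assignment. -/
def IFPart {V : Type*} (G : SimpleGraph V) (I F A : Set V) : Prop :=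
  I ⊆ A ∧ Disjoint F A ∧ TwoIndependent G A ∧
    ∀ T : Finset V, T.Nonempty → Disjoint (T : Set V) A → xe G T T < 2 * (T.card : ℤ)

lemma part_iff {V : Type*} [Fintype V] (G : SimpleGraph V) (I F : Set V) :
    (∃ A, IFPart G I F A) ↔ ∃ A B : Set V, IsIFPartition G A B ∧ I ⊆ A ∧ F ⊆ B := by
  constructor
  · rintro ⟨A, h1, h2, h3, h4⟩
    refine ⟨A, Aᶜ, ⟨Set.union_compl_self A, disjoint_compl_right, h3, ?_⟩, h1,
      Set.disjoint_left.1 h2⟩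
    rw [acyclic_iff_count]
    intro T hT hTA
    exact h4 T hT (Set.disjoint_left.2 fun x hx => hTA hx)
  · rintro ⟨A, B, ⟨h1, h2, h3, h4⟩, h5, h6⟩
    refine ⟨A, h5, (h2.mono_right h6).symm, h3, ?_⟩
    rw [acyclic_iff_count] at h4
    intro T hT hTA
    refine h4 T hT fun x hx => ?_
    have : x ∈ A ∪ B := by rw [h1]; trivial
    exact this.resolve_left (Set.disjoint_left.1 hTA hx)

lemma min_cex_apply {V : Type*} [Fintype V] {G : SimpleGraph V} {I F U : Set V}
    (hmin : IsMinCounterexample G I F U) {V' : Type*} [Fintype V'] (G' : SimpleGraph V')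
    (I' F' : Set V') (hd : Disjoint I' F')
    (hpot : ∀ T : Finset V', T.Nonempty → 0 < pot G' I' F' T)
    (hsize : 2 * (Fintype.card V' : ℤ) + xe G' Finset.univ Finset.univ <
      2 * (Fintype.card V : ℤ) + xe G Finset.univ Finset.univ) :
    ∃ A, IFPart G' I' F' A := by
  classical
  by_contra hno
  let e := (Fintype.equivFin V').symm
  let f : Fin (Fintype.card V') ↪ V' := e.toEmbedding
  let H : SimpleGraph (Fin (Fintype.card V')) := G'.comap f
  have hadj : ∀ a b, H.Adj a b ↔ G'.Adj (f a) (f b) := fun a b => Iff.rfl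
  have hAs : IsAssignment (f ⁻¹' I') (f ⁻¹' F') (f ⁻¹' (I' ∪ F')ᶜ) := by
    refine ⟨?_, hd.preimage _, ?_, ?_⟩
    · rw [← Set.preimage_union, ← Set.preimage_union, Set.union_compl_self, Set.preimage_univ]
    · exact Set.disjoint_left.2 fun x hx hx' => hx' (Or.inl hx)
    · exact Set.disjoint_left.2 fun x hx hx' => hx' (Or.inr hx)
  have hC : IsCounterexample H (f ⁻¹' I') (f ⁻¹' F') (f ⁻¹' (I' ∪ F')ᶜ) := by
    refine ⟨hAs, ?_, ?_⟩
    · intro K hK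
      have hT : K.verts = (K.verts.toFinset : Set _) := by simp
      have h1 := rho_le H _ _ _ hAs K.verts.toFinset K hT
      rw [pot_map G' H f hadj] at h1
      have := hpot (K.verts.toFinset.map f) (by simpa using hK)
      linarith
    · rw [← part_iff]
      rintro ⟨A, h1, h2, h3, h4⟩
      refine hno ⟨f '' A, ?_, ?_, ?_, ?_⟩
      · intro x hx
        refine ⟨e.symm x, h1 ?_, by simp [f]⟩
        simpa [f] using hx
      · rw [Set.disjoint_left] at h2 ⊢
        rintro _ hx ⟨y, hy, rfl⟩
        exact h2 hx hy
      · rintro _ ⟨x, hx, rfl⟩ _ ⟨y, hy, rfl⟩ hxy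
        obtain ⟨a, b⟩ := h3 x hx y hy (fun h => hxy (by rw [h]))
        refine ⟨a, fun w hw => b (e.symm w) ?_⟩
        simpa [hadj, f] using hw
      · intro T hT hTA
        have hm : (T.map e.symm.toEmbedding).map f = T := by
          ext x; simp [f]
        have := h4 (T.map e.symm.toEmbedding) (by simpa using hT) (by
          rw [Set.disjoint_left] at hTA ⊢
          intro x hx hxA
          refine hTA (a := f x) ?_ ⟨x, hxA, rfl⟩
          simp only [Finset.coe_map, Set.mem_image] at hx
          obtain ⟨y, hy, rfl⟩ := hx
          simpa [f] using hy)
        rwa [xe_map G' H f hadj, hm, Finset.card_map] at this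
  have := hmin.2 _ _ _ _ _ hC
  have h1 := xe_univ G
  have h2 := xe_univ H
  have h3 := xe_map G' H f hadj Finset.univ Finset.univ
  have h4 : Finset.univ.map f = Finset.univ := by ext x; simp [f]
  rw [h4] at h3
  unfold edgeCount at this
  omega
/-- Relative version of `IFPart` on a vertex subset `S`. -/
def RelPart {V : Type*} (G : SimpleGraph V) (S : Finset V) (I F A : Set V) : Prop :=
  (∀ x ∈ S, x ∈ I → x ∈ A) ∧ (∀ x ∈ S, x ∈ F → x ∉ A) ∧
  (∀ u ∈ S, ∀ v ∈ S, u ∈ A → v ∈ A → u ≠ v → ¬ G.Adj u v ∧ ∀ w ∈ S, ¬ (G.Adj u w ∧ G.Adj w v)) ∧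
    ∀ T : Finset V, T.Nonempty → T ⊆ S → (∀ x ∈ T, x ∉ A) → xe G T T < 2 * (T.card : ℤ)

section main
variable {V : Type*} [Fintype V] {G : SimpleGraph V} {I F U : Set V}

lemma sub_part (hmin : IsMinCounterexample G I F U) (S : Finset V) (hS : S ≠ Finset.univ)
    (F' : Set V) (hd : Disjoint I F')
    (hpot : ∀ T : Finset V, T.Nonempty → T ⊆ S → 0 < pot G I F' T) :
    ∃ A, RelPart G S I F' A := by
  classical
  let f : {x // x ∈ S} ↪ V := Function.Embedding.subtype _
  let H : SimpleGraph {x // x ∈ S} := G.comap f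
  have hadj : ∀ a b, H.Adj a b ↔ G.Adj (f a) (f b) := fun a b => Iff.rfl
  have hmapS : ∀ T : Finset {x // x ∈ S}, T.map f ⊆ S := by
    intro T x hx
    obtain ⟨y, _, rfl⟩ := Finset.mem_map.1 hx
    exact y.2
  obtain ⟨A, h1, h2, h3, h4⟩ := min_cex_apply hmin H (f ⁻¹' I) (f ⁻¹' F') (hd.preimage _) (by
      intro T hT
      rw [pot_map G H f hadj]
      exact hpot _ (by simpa using hT) (hmapS T)) (by
      rw [xe_map G H f hadj]
      have a1 : xe G (Finset.univ.map f) (Finset.univ.map f) ≤ xe G Finset.univ Finset.univ :=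
        (xe_mono_left _ (Finset.subset_univ _)).trans (xe_mono_right _ (Finset.subset_univ _))
      have a2 : S.card < Fintype.card V := by
        rw [← Finset.card_univ]
        exact Finset.card_lt_card (Finset.ssubset_univ_iff.2 hS)
      rw [Fintype.card_coe]
      omega)
  refine ⟨f '' A, ?_, ?_, ?_, ?_⟩
  · intro x hx hxI
    exact ⟨⟨x, hx⟩, h1 hxI, rfl⟩
  · rintro _ _ hF ⟨y, hy, rfl⟩
    exact Set.disjoint_left.1 h2 hF hy
  · rintro _ _ _ _ ⟨u, hu, rfl⟩ ⟨v, hv, rfl⟩ huv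
    obtain ⟨a, b⟩ := h3 u hu v hv (fun h => huv (by rw [h]))
    exact ⟨a, fun w hw => b ⟨w, hw⟩⟩
  · intro T hT hTS hTA
    have hm : (T.subtype (· ∈ S)).map f = T := by
      ext x
      simp only [Finset.mem_map, Finset.mem_subtype, f]
      constructor
      · rintro ⟨y, hy, rfl⟩; exact hy
      · intro hx; exact ⟨⟨x, hTS hx⟩, hx, rfl⟩
    have := h4 (T.subtype (· ∈ S)) (by rw [← Finset.map_nonempty (f := f), hm]; exact hT) (by
      rw [Set.disjoint_left]
      intro x hx hxA
      exact hTA (f x) (by simpa [f] using hx) ⟨x, hxA, rfl⟩)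
    rwa [xe_map G H f hadj, hm, ← Finset.card_map f, hm] at this

/-- Replace `S` by the gadget `GK`. -/
def glueG {V : Type*} (G : SimpleGraph V) (S : Finset V) (GK : SimpleGraph Bool) (f : V → Bool) :
    SimpleGraph ({x // x ∉ S} ⊕ Bool) where
  Adj a b := match a, b with
    | .inl a, .inl b => G.Adj a b
    | .inl a, .inr k => ∃ s ∈ S, f s = k ∧ G.Adj a s
    | .inr k, .inl a => ∃ s ∈ S, f s = k ∧ G.Adj a s
    | .inr k, .inr l => GK.Adj k l
  symm := ⟨by
    rintro (a | a) (b | b) h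
    · exact SimpleGraph.Adj.symm (G := G) h
    · exact h
    · exact h
    · exact SimpleGraph.Adj.symm (G := GK) h⟩
  loopless := ⟨by
    rintro (a | a) h
    · exact G.loopless.irrefl _ h
    · exact GK.loopless.irrefl _ h⟩

lemma glue_xe [DecidableEq V] (S : Finset V) (GK : SimpleGraph Bool) (f : V → Bool)
    (hn : ∀ w ∉ S, ∀ s ∈ S, ∀ s' ∈ S, G.Adj w s → G.Adj w s' → s = s')
    (W : Finset {x // x ∉ S}) (K : Finset Bool) :
    xe (glueG G S GK f) (W.disjSum K) (W.disjSum K) =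
      xe G (W.map (Function.Embedding.subtype _)) (W.map (Function.Embedding.subtype _)) +
      xe GK K K + 2 * xe G (W.map (Function.Embedding.subtype _)) (S.filter (fun s => f s ∈ K)) := by
  have h1 : ∀ w : {x // x ∉ S}, ∑ k ∈ K, ad (glueG G S GK f) (.inl w) (.inr k) =
      ∑ s ∈ S.filter (fun s => f s ∈ K), ad G w s := by
    intro w
    by_cases h : ∃ s ∈ S, G.Adj w s
    · obtain ⟨s0, hs0, hws0⟩ := h
      have e1 : ∀ k, ad (glueG G S GK f) (.inl w) (.inr k) = if f s0 = k then 1 else 0 := by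
        intro k
        split_ifs with hk
        · exact ad_one _ ⟨s0, hs0, hk, hws0⟩
        · refine ad_zero _ ?_
          rintro ⟨s, hs, hk', hws⟩
          rw [hn w w.2 s hs s0 hs0 hws hws0] at hk'
          exact hk hk'
      have e2 : ∀ s ∈ S.filter (fun s => f s ∈ K), ad G w s = if s0 = s then 1 else 0 := by
        intro s hs
        split_ifs with hk
        · exact ad_one _ (hk ▸ hws0)
        · refine ad_zero _ fun hws => ?_
          exact hk (hn w w.2 s0 hs0 s (Finset.mem_filter.1 hs).1 hws0 hws)
      rw [Finset.sum_congr rfl e2, Finset.sum_congr rfl fun k _ => e1 k,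
        Finset.sum_ite_eq, Finset.sum_ite_eq]
      simp [hs0]
    · rw [Finset.sum_eq_zero, Finset.sum_eq_zero]
      · intro s hs
        exact ad_zero _ fun hh => h ⟨s, (Finset.mem_filter.1 hs).1, hh⟩
      · intro k _
        refine ad_zero _ ?_
        rintro ⟨s, hs, _, hh⟩
        exact h ⟨s, hs, hh⟩
  have h2 : ∑ w ∈ W, ∑ k ∈ K, ad (glueG G S GK f) (.inl w) (.inr k) =
      xe G (W.map (Function.Embedding.subtype _)) (S.filter (fun s => f s ∈ K)) := by
    unfold xe
    rw [Finset.sum_map]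
    exact Finset.sum_congr rfl fun w _ => h1 w
  have h3 : ∑ k ∈ K, ∑ w ∈ W, ad (glueG G S GK f) (.inr k) (.inl w) =
      xe G (W.map (Function.Embedding.subtype _)) (S.filter (fun s => f s ∈ K)) := by
    rw [← h2, Finset.sum_comm]
    exact Finset.sum_congr rfl fun _ _ => Finset.sum_congr rfl fun _ _ => ad_comm _ _ _
  have h4 : ∑ w ∈ W, ∑ w' ∈ W, ad (glueG G S GK f) (.inl w) (.inl w') =
      xe G (W.map (Function.Embedding.subtype _)) (W.map (Function.Embedding.subtype _)) := by
    unfold xe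
    simp only [Finset.sum_map]
    exact Finset.sum_congr rfl fun _ _ => Finset.sum_congr rfl fun _ _ => ad_congr _ _ Iff.rfl
  have h5 : ∑ k ∈ K, ∑ l ∈ K, ad (glueG G S GK f) (.inr k) (.inr l) = xe GK K K := by
    unfold xe
    exact Finset.sum_congr rfl fun _ _ => Finset.sum_congr rfl fun _ _ => ad_congr _ _ Iff.rfl
  rw [xe, Finset.sum_disjSum]
  simp only [Finset.sum_disjSum, Finset.sum_add_distrib]
  rw [h2, h3, h4, h5]
  ring

lemma glue (hmin : IsMinCounterexample G I F U) (S : Finset V)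
    (hsz : 10 ≤ 2 * (S.card : ℤ) + xe G S S)
    (hpos : ∀ T : Finset V, T.Nonempty → 0 < pot G I F T)
    (hn : ∀ w ∉ S, ∀ s ∈ S, ∀ s' ∈ S, G.Adj w s → G.Adj w s' → s = s')
    (A : Set V) (hA : RelPart G S I F A)
    (GK : SimpleGraph Bool) (IK FK : Set Bool) (hdK : Disjoint IK FK)
    (hszK : xe GK Finset.univ Finset.univ ≤ 2) (f : V → Bool)
    (hpot : ∀ W : Finset V, Disjoint W S → ∀ K : Finset Bool, K.Nonempty → ∀ W' : Finset V,
      (∀ x, x ∈ W' ↔ x ∈ W ∨ x ∈ S) → ∀ Z : Finset V, (∀ x, x ∈ Z ↔ x ∈ S ∧ f x ∉ K) →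
      0 < pot G I F W' - pot G I F S + pot GK IK FK K + 8 * xe G W Z)
    (hfA : ∀ s ∈ S, ∀ w ∉ S, G.Adj w s → s ∈ A → f s ∈ IK)
    (hfB : ∀ s ∈ S, ∀ w ∉ S, G.Adj w s → s ∉ A → f s = true ∧ GK.Adj true false ∧ false ∈ IK) :
    False := by
  classical
  obtain ⟨⟨hAs, _, hno⟩, _⟩ := id hmin
  rw [← part_iff] at hno
  let em : {x // x ∉ S} ↪ V := Function.Embedding.subtype _
  have hWS : ∀ W : Finset {x // x ∉ S}, Disjoint (W.map em) S := by
    intro W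
    rw [Finset.disjoint_left]
    intro x hx
    obtain ⟨y, _, rfl⟩ := Finset.mem_map.1 hx
    exact y.2
  let I' : Set ({x // x ∉ S} ⊕ Bool) := {x | Sum.elim (fun a : {x // x ∉ S} => (a : V) ∈ I) (· ∈ IK) x}
  let F' : Set ({x // x ∉ S} ⊕ Bool) := {x | Sum.elim (fun a : {x // x ∉ S} => (a : V) ∈ F) (· ∈ FK) x}
  have hwtl : ∀ a, wt I' F' (.inl a) = wt I F (a : V) := fun a => by rfl
  have hwtr : ∀ k, wt I' F' (.inr k) = wt IK FK k := fun a => by rfl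
  obtain ⟨A', h1, h2, h3, h4⟩ := min_cex_apply hmin (glueG G S GK f) I' F' (by
      rw [Set.disjoint_left]
      rintro (x | x) hx hx'
      · exact Set.disjoint_left.1 hAs.2.1 hx hx'
      · exact Set.disjoint_left.1 hdK hx hx') (by
      intro T hT
      rw [← Finset.toLeft_disjSum_toRight (u := T)]
      have hxe := glue_xe (G := G) S GK f hn T.toLeft T.toRight
      have hTne : T.toLeft.Nonempty ∨ T.toRight.Nonempty := by
        obtain ⟨x | x, hx⟩ := hT
        · exact Or.inl ⟨x, by simpa using hx⟩
        · exact Or.inr ⟨x, by simpa using hx⟩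
      generalize T.toLeft = W at *
      generalize T.toRight = K at *
      have hp : pot (glueG G S GK f) I' F' (W.disjSum K) = pot G I F (W.map em) + pot GK IK FK K -
          8 * xe G (W.map em) (S.filter (fun s => f s ∈ K)) := by
        unfold pot
        rw [hxe, Finset.sum_disjSum, Finset.sum_map]
        simp only [hwtl, hwtr, em, Function.Embedding.subtype_apply]
        ring
      rw [hp]
      rcases K.eq_empty_or_nonempty with rfl | hK
      · have hW : W.Nonempty := by simpa using hTne
        have := hpos (W.map em) (by simpa using hW)
        simpa [pot, xe] using this
      · have a1 := hpot (W.map em) (hWS W) K hK (W.map em ∪ S) (by simp)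
          (S.filter (fun s => f s ∉ K)) (by simp)
        rw [pot_union G I F (hWS W)] at a1
        have a2 : xe G (W.map em) S = xe G (W.map em) (S.filter (fun s => f s ∈ K)) +
            xe G (W.map em) (S.filter (fun s => f s ∉ K)) := by
          rw [← xe_union_right G _ (Finset.disjoint_filter_filter_not _ _ _),
            Finset.filter_union_filter_not_eq]
        linarith) (by
      have hxe := glue_xe (G := G) S GK f hn Finset.univ Finset.univ
      have hu : (Finset.univ : Finset {x // x ∉ S}).disjSum (Finset.univ : Finset Bool) =
        Finset.univ := by ext x; cases x <;> simp
      have hu2 : (Finset.univ : Finset {x // x ∉ S}).map em ∪ S = Finset.univ := by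
        ext x; by_cases hx : x ∈ S <;> simp [hx, em]
      have hc := Finset.card_union_of_disjoint (hWS Finset.univ)
      have hx := xe_union_self G (hWS Finset.univ)
      rw [hu2] at hc hx
      rw [hu] at hxe
      rw [hxe, hx, ← Finset.card_univ (α := V), hc, Finset.card_map, Fintype.card_sum,
        Fintype.card_bool, Finset.card_univ]
      have hff : S.filter (fun s => f s ∈ Finset.univ) = S := by simp
      rw [hff]
      push_cast
      simp only [em] at *
      linarith)
  obtain ⟨r1, r2, r3, r4⟩ := hA
  have hA' : ∀ s ∈ S, ∀ w ∉ S, G.Adj w s → s ∈ A → .inr (f s) ∈ A' := by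
    intro s hs w hw hws hsA
    exact h1 (hfA s hs w hw hws hsA)
  have hTr : ∀ s ∈ S, ∀ w ∉ S, G.Adj w s → s ∉ A →
      .inr true ∉ A' ∧ .inr false ∈ A' ∧ f s = true ∧ GK.Adj true false := by
    intro s hs w hw hws hsA
    obtain ⟨b1, b2, b3⟩ := hfB s hs w hw hws hsA
    have b4 : .inr false ∈ A' := h1 (show (Sum.inr false) ∈ I' from b3)
    refine ⟨fun hh => ?_, b4, b1, b2⟩
    exact (h3 _ hh _ b4 (by simp)).1 b2
  -- the glued independent set
  let B : Set V := {x | (x ∈ S ∧ x ∈ A) ∨ ∃ h : x ∉ S, .inl ⟨x, h⟩ ∈ A'}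
  have hBS : ∀ x ∈ S, (x ∈ B ↔ x ∈ A) := by
    intro x hx
    constructor
    · rintro (h | ⟨h, _⟩)
      · exact h.2
      · exact absurd hx h
    · exact fun h => Or.inl ⟨hx, h⟩
  have hBO : ∀ x (h : x ∉ S), (x ∈ B ↔ .inl ⟨x, h⟩ ∈ A') := by
    intro x hx
    constructor
    · rintro (h | ⟨h, h'⟩)
      · exact absurd h.1 hx
      · exact h'
    · exact fun h => Or.inr ⟨hx, h⟩
  -- mixed pairs
  have mixed : ∀ u ∈ S, ∀ v ∉ S, u ∈ B → v ∈ B → ¬ G.Adj v u ∧ ∀ w, ¬ (G.Adj u w ∧ G.Adj w v) := by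
    intro u hu v hv huB hvB
    rw [hBS u hu] at huB
    rw [hBO v hv] at hvB
    constructor
    · intro hvu
      have := hA' u hu v hv hvu huB
      exact (h3 _ hvB _ this (by simp)).1 ⟨u, hu, rfl, hvu⟩
    · rintro w ⟨huw, hwv⟩
      by_cases hw : w ∈ S
      · by_cases hwA : w ∈ A
        · exact (r3 u hu w hw huB hwA huw.ne).1 huw
        · obtain ⟨c1, c2, c3, c4⟩ := hTr w hw v hv hwv.symm hwA
          refine (h3 _ hvB _ c2 (by simp)).2 (.inr true) ⟨⟨w, hw, c3, hwv.symm⟩, c4⟩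
      · have := hA' u hu w hw huw.symm huB
        exact (h3 _ hvB _ this (by simp)).2 (.inl ⟨w, hw⟩) ⟨hwv.symm, ⟨u, hu, rfl, huw.symm⟩⟩
  apply hno
  refine ⟨B, ?_, ?_, ?_, ?_⟩
  · intro x hx
    by_cases hxS : x ∈ S
    · exact (hBS x hxS).2 (r1 x hxS hx)
    · exact (hBO x hxS).2 (h1 (show Sum.inl ⟨x, hxS⟩ ∈ I' from hx))
  · rw [Set.disjoint_left]
    intro x hx hxB
    by_cases hxS : x ∈ S
    · exact r2 x hxS hx ((hBS x hxS).1 hxB)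
    · exact Set.disjoint_left.1 h2 (show Sum.inl ⟨x, hxS⟩ ∈ F' from hx) ((hBO x hxS).1 hxB)
  · intro u hu v hv huv
    by_cases huS : u ∈ S <;> by_cases hvS : v ∈ S
    · obtain ⟨c1, c2⟩ := r3 u huS v hvS ((hBS u huS).1 hu) ((hBS v hvS).1 hv) huv
      refine ⟨c1, fun w hw => ?_⟩
      by_cases hwS : w ∈ S
      · exact c2 w hwS hw
      · exact huv (hn w hwS u huS v hvS hw.1.symm hw.2)
    · obtain ⟨c1, c2⟩ := mixed u huS v hvS hu hv
      exact ⟨fun h => c1 h.symm, c2⟩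
    · obtain ⟨c1, c2⟩ := mixed v hvS u huS hv hu
      exact ⟨c1, fun w hw => c2 w ⟨hw.2.symm, hw.1.symm⟩⟩
    · obtain ⟨c1, c2⟩ := h3 _ ((hBO u huS).1 hu) _ ((hBO v hvS).1 hv) (by simpa using huv)
      refine ⟨c1, fun w hw => ?_⟩
      by_cases hwS : w ∈ S
      · exact c2 (.inr (f w)) ⟨⟨w, hwS, rfl, hw.1⟩, ⟨w, hwS, rfl, hw.2.symm⟩⟩
      · exact c2 (.inl ⟨w, hwS⟩) hw
  · intro T hT hTB
    rw [Set.disjoint_left] at hTB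
    let W : Finset {x // x ∉ S} := T.subtype (· ∉ S)
    have hWm : W.map em = T.filter (· ∉ S) := by
      ext x
      simp only [Finset.mem_map, Finset.mem_subtype, Finset.mem_filter, W, em]
      constructor
      · rintro ⟨y, hy, rfl⟩; exact ⟨hy, y.2⟩
      · rintro ⟨hx, hxS⟩; exact ⟨⟨x, hxS⟩, hx, rfl⟩
    have hWA : ∀ x ∈ W, .inl x ∉ A' := by
      intro x hx hxA
      exact hTB (a := (x : V)) (by simpa [W] using hx) ((hBO x x.2).2 hxA)
    have hTu : W.map em ∪ T.filter (· ∈ S) = T := by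
      rw [hWm, Finset.union_comm, Finset.filter_union_filter_not_eq]
    have hdis : Disjoint (W.map em) (T.filter (· ∈ S)) :=
      (hWS W).mono_right fun x hx => (Finset.mem_filter.1 hx).2
    have hc := Finset.card_union_of_disjoint hdis
    have hx := xe_union_self G hdis
    rw [hTu] at hc hx
    rw [Finset.card_map] at hc
    have q1 : (T.filter (· ∈ S)).Nonempty → xe G (T.filter (· ∈ S)) (T.filter (· ∈ S)) <
        2 * ((T.filter (· ∈ S)).card : ℤ) := by
      intro hne
      refine r4 _ hne (fun x hx => (Finset.mem_filter.1 hx).2) fun x hx hxA => ?_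
      obtain ⟨hxT, hxS⟩ := Finset.mem_filter.1 hx
      exact hTB hxT ((hBS x hxS).2 hxA)
    have q2 : ∀ K : Finset Bool, (W.disjSum K).Nonempty → (∀ k ∈ K, .inr k ∉ A') →
        xe G (W.map em) (W.map em) + xe GK K K +
          2 * xe G (W.map em) (S.filter (fun s => f s ∈ K)) < 2 * ((W.card : ℤ) + K.card) := by
      intro K hK hKA
      have := h4 (W.disjSum K) hK (by
        rw [Set.disjoint_left]
        rintro (x | x) hx
        · exact hWA x (by simpa using hx)
        · exact hKA x (by simpa using hx))
      rw [glue_xe (G := G) S GK f hn, Finset.card_disjSum] at this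
      push_cast at this
      exact this
    by_cases hedge : ∃ s ∈ T.filter (· ∈ S), ∃ w ∈ W.map em, G.Adj w s
    · obtain ⟨s, hs, w, hw, hws⟩ := hedge
      have key : ∀ s ∈ T.filter (· ∈ S), ∀ w ∈ W.map em, G.Adj w s →
          .inr true ∉ A' ∧ f s = true := by
        intro s hs w hw hws
        obtain ⟨hsT, hsS⟩ := Finset.mem_filter.1 hs
        have hsA : s ∉ A := fun h => hTB hsT ((hBS s hsS).2 h)
        obtain ⟨c1, c2, c3, c4⟩ := hTr s hsS w (Finset.disjoint_left.1 (hWS W) hw) hws hsA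
        exact ⟨c1, c3⟩
      have p1 := q1 ⟨s, hs⟩
      have p2 := q2 {true} ⟨.inr true, by simp⟩ (by
        intro k hk
        rw [Finset.mem_singleton.1 hk]
        exact (key s hs w hw hws).1)
      have p3 : xe G (W.map em) (T.filter (· ∈ S)) ≤
          xe G (W.map em) (S.filter (fun s => f s ∈ ({true} : Finset Bool))) := by
        have : xe G (W.map em) (T.filter (· ∈ S)) =
            xe G (W.map em) ((T.filter (· ∈ S)).filter (fun s => f s = true)) := by
          have e := xe_union_right G (W.map em) (Finset.disjoint_filter_filter_not
            (T.filter (· ∈ S)) (T.filter (· ∈ S)) (fun s => f s = true))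
          rw [Finset.filter_union_filter_not_eq] at e
          rw [e, xe_eq_zero G (B := Finset.filter (fun s => ¬ f s = true) _), add_zero]
          intro w hw s hs hws
          obtain ⟨hs1, hs2⟩ := Finset.mem_filter.1 hs
          exact hs2 (key s hs1 w hw hws).2
        rw [this]
        refine xe_mono_right G ?_
        intro s hs
        simp only [Finset.mem_filter, Finset.mem_singleton] at hs ⊢
        exact ⟨hs.1.2, hs.2⟩
      have p4 := xe_nonneg GK {true} {true}
      rw [hx, hc]
      simp only [Finset.card_singleton] at p2
      push_cast at p2 ⊢
      have p5 : xe G (Finset.filter (· ∈ S) T) (Finset.filter (· ∈ S) T) ≠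
        2 * ((T.filter (· ∈ S)).card : ℤ) - 1 := by
        have := edgeCount_induce G (T.filter (· ∈ S))
        omega
      have p6 := edgeCount_induce G (T.filter (· ∈ S))
      have p7 := edgeCount_induce G (W.map em)
      omega
    · push Not at hedge
      have z : xe G (W.map em) (T.filter (· ∈ S)) = 0 :=
        xe_eq_zero G fun w hw s hs => hedge s hs w hw
      rw [hx, hc, z]
      push_cast
      rcases W.eq_empty_or_nonempty with hW | hW
      · have hne : (T.filter (· ∈ S)).Nonempty := by
          rw [hW] at hTu
          simp only [Finset.map_empty, Finset.empty_union] at hTu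
          rw [hTu]; exact hT
        have := q1 hne
        rw [hW]
        simpa [xe] using this
      · have p2 := q2 ∅ (by simpa using hW) (by simp)
        have ee : S.filter (fun s => f s ∈ (∅ : Finset Bool)) = ∅ := by simp
        rw [ee, Finset.card_empty] at p2
        have e0 : ∀ A : Finset V, xe G A ∅ = 0 := fun A => by simp [xe]
        have e1 : xe GK ∅ ∅ = 0 := by simp [xe]
        rw [e0, e1] at p2
        rcases (T.filter (· ∈ S)).eq_empty_or_nonempty with h0 | h0
        · rw [h0, e0, Finset.card_empty]; push_cast at p2 ⊢; linarith
        · have := q1 h0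
          push_cast at p2
          linarith
lemma pot_even (hAs : IsAssignment I F U) (T : Finset V) : ∃ k : ℤ, pot G I F T = 2 * k :=
  ⟨_, (rhoSet_eq G I F U hAs T).symm⟩

lemma bool_cases (K : Finset Bool) (h : K.Nonempty) :
    K = {true} ∨ K = {false} ∨ K = Finset.univ := by
  revert K; decide

lemma pot_pos (hmin : IsMinCounterexample G I F U) (T : Finset V) (hT : T.Nonempty) :
    2 ≤ pot G I F T := by
  have h1 := rho_induce G I F U hmin.1.1 T
  have h2 := hmin.1.2.1 ((⊤ : G.Subgraph).induce T) (by simpa using hT)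
  omega

lemma wt_bounds (I F : Set V) (v : V) : 1 ≤ wt I F v ∧ wt I F v ≤ 5 := by
  unfold wt; split_ifs <;> simp

lemma unique_nbr (hmin : IsMinCounterexample G I F U) (S : Finset V) (hS : pot G I F S ≤ 4) :
    ∀ w ∉ S, ∀ s ∈ S, ∀ s' ∈ S, G.Adj w s → G.Adj w s' → s = s' := by
  classical
  intro w hw s hs s' hs' h h'
  by_contra hne
  have h1 := pot_union G I F (A := {w}) (B := S) (by simpa using hw)
  have h2 := pot_pos hmin ({w} ∪ S) (by simp)
  have h3 : pot G I F {w} ≤ 10 := by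
    have := (wt_bounds I F w).2
    have h0 := xe_nonneg G {w} {w}
    simp only [pot, Finset.sum_singleton]
    linarith
  have h4 : 2 ≤ xe G {w} S := by
    have a1 : xe G {w} {s, s'} = 2 := by
      unfold xe
      rw [Finset.sum_singleton, Finset.sum_pair hne, ad_one G h, ad_one G h']
      rfl
    rw [← a1]
    refine xe_mono_right G ?_
    intro x hx
    rcases Finset.mem_insert.1 hx with rfl | hx
    · exact hs
    · rw [Finset.mem_singleton.1 hx]; exact hs'
  linarith

lemma xe_top_bool : xe (⊤ : SimpleGraph Bool) Finset.univ Finset.univ = 2 := by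
  simp [xe, ad]

lemma case_a (hmin : IsMinCounterexample G I F U) (S : Finset V)
    (hsz : 10 ≤ 2 * (S.card : ℤ) + xe G S S) (hS : pot G I F S ≤ 4) (hpr : S ≠ Finset.univ)
    (hge : ∀ W : Finset V, S ⊆ W → pot G I F S ≤ pot G I F W) : False := by
  classical
  have hpos : ∀ T : Finset V, T.Nonempty → 0 < pot G I F T := fun T hT => by
    have := pot_pos hmin T hT
    omega
  obtain ⟨A, hA⟩ := sub_part hmin S hpr F hmin.1.1.2.1 fun T hT _ => hpos T hT
  refine glue hmin S hsz hpos (unique_nbr hmin S hS) A hA ⊤ {false} {true} (by simp)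
    xe_top_bool.le (fun s => decide (s ∉ A)) ?_ ?_ ?_
  · intro W _ K hK W' hW' Z _
    have h1 := hge W' fun x hx => (hW' x).2 (Or.inr hx)
    have h2 := xe_nonneg G W Z
    have h3 : 2 ≤ pot (⊤ : SimpleGraph Bool) {false} {true} K := by
      rcases bool_cases K hK with rfl | rfl | rfl <;> simp [pot, wt, xe, ad]
    linarith
  · intro s _ w _ _ h
    simp [h]
  · intro s _ w _ _ h
    simp [h]

lemma case_b (hmin : IsMinCounterexample G I F U) (S : Finset V)
    (hsz : 10 ≤ 2 * (S.card : ℤ) + xe G S S) (hS : pot G I F S = 4)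
    (hge : ∀ W : Finset V, S ⊆ W → W ≠ Finset.univ → 4 ≤ pot G I F W)
    (A : Set V) (hA : RelPart G S I F A) (s w : V) (hs : s ∈ S) (hw : w ∉ S) (hsw : G.Adj w s)
    (hsA : s ∉ A) : False := by
  classical
  have hpos : ∀ T : Finset V, T.Nonempty → 0 < pot G I F T := fun T hT => by
    have := pot_pos hmin T hT
    omega
  refine glue hmin S hsz hpos (unique_nbr hmin S hS.le) A hA ⊤ {false} ∅ (by simp)
    xe_top_bool.le (fun s => decide (s ∉ A)) ?_ ?_ ?_
  · intro W hWS K hK W' hW' Z hZ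
    have h1 := pot_pos hmin W' ⟨s, (hW' s).2 (Or.inr hs)⟩
    have h2 := xe_nonneg G W Z
    rcases bool_cases K hK with rfl | rfl | rfl
    · have h3 : pot (⊤ : SimpleGraph Bool) {false} ∅ {true} = 10 := by
        simp [pot, wt, xe, ad]
      linarith
    · have h3 : pot (⊤ : SimpleGraph Bool) {false} ∅ {false} = 2 := by
        simp [pot, wt, xe, ad]
      by_cases hu : W' = Finset.univ
      · have hwW : w ∈ W := by
          have : w ∈ W' := by rw [hu]; simp
          exact ((hW' w).1 this).resolve_right hw
        have := xe_pos G hwW ((hZ s).2 ⟨hs, by simp [hsA]⟩) hsw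
        linarith
      · have := hge W' (fun x hx => (hW' x).2 (Or.inr hx)) hu
        linarith
    · have h3 : pot (⊤ : SimpleGraph Bool) {false} ∅ Finset.univ = 4 := by
        simp [pot, wt, xe, ad]
      linarith
  · intro s _ w _ _ h
    simp [h]
  · intro s _ w _ _ h
    simp [h]

lemma case_c (hmin : IsMinCounterexample G I F U) (S : Finset V)
    (hsz : 10 ≤ 2 * (S.card : ℤ) + xe G S S) (hS : pot G I F S = 4) (hSne : S.Nonempty)
    (hge : ∀ W : Finset V, S ⊆ W → W ≠ Finset.univ → 4 ≤ pot G I F W)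
    (A : Set V) (hA : RelPart G S I F A)
    (hall : ∀ s ∈ S, ∀ w ∉ S, G.Adj w s → s ∈ A) (s w s' w' : V) (hs : s ∈ S) (hw : w ∉ S)
    (hsw : G.Adj w s) (hs' : s' ∈ S) (hw' : w' ∉ S) (hsw' : G.Adj w' s') (hne : s' ≠ s) :
    False := by
  classical
  have hpos : ∀ T : Finset V, T.Nonempty → 0 < pot G I F T := fun T hT => by
    have := pot_pos hmin T hT
    omega
  refine glue hmin S hsz hpos (unique_nbr hmin S hS.le) A hA ⊥ Set.univ ∅ (by simp)
    (by simp [xe, ad]) (fun x => decide (x = s)) ?_ ?_ ?_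
  · intro W hWS K hK W' hW' Z hZ
    have h1 := pot_pos hmin W' ⟨s, (hW' s).2 (Or.inr hs)⟩
    have h2 := xe_nonneg G W Z
    rcases bool_cases K hK with rfl | rfl | rfl
    · have h3 : pot (⊥ : SimpleGraph Bool) Set.univ ∅ {true} = 2 := by
        simp [pot, wt, xe, ad]
      by_cases hu : W' = Finset.univ
      · have hwW : w' ∈ W := by
          have : w' ∈ W' := by rw [hu]; simp
          exact ((hW' w').1 this).resolve_right hw'
        have := xe_pos G hwW ((hZ s').2 ⟨hs', by simp [hne]⟩) hsw'
        linarith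
      · have := hge W' (fun x hx => (hW' x).2 (Or.inr hx)) hu
        linarith
    · have h3 : pot (⊥ : SimpleGraph Bool) Set.univ ∅ {false} = 2 := by
        simp [pot, wt, xe, ad]
      by_cases hu : W' = Finset.univ
      · have hwW : w ∈ W := by
          have : w ∈ W' := by rw [hu]; simp
          exact ((hW' w).1 this).resolve_right hw
        have := xe_pos G hwW ((hZ s).2 ⟨hs, by simp⟩) hsw
        linarith
      · have := hge W' (fun x hx => (hW' x).2 (Or.inr hx)) hu
        linarith
    · have h3 : pot (⊥ : SimpleGraph Bool) Set.univ ∅ Finset.univ = 4 := by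
        simp [pot, wt, xe, ad]
      linarith
  · intro s _ w _ _ h
    exact Set.mem_univ _
  · intro s hs w hw hsw h
    exact absurd (hall s hs w hw hsw) h

lemma step_one (hmin : IsMinCounterexample G I F U) (S : Finset V)
    (hsz : 10 ≤ 2 * (S.card : ℤ) + xe G S S) (hpr : S ≠ Finset.univ) : 4 ≤ pot G I F S := by
  have hne : S.Nonempty := by
    rcases S.eq_empty_or_nonempty with rfl | h
    · simp [xe] at hsz
    · exact h
  by_contra hlt
  obtain ⟨k, hk⟩ := pot_even (G := G) hmin.1.1 S
  refine case_a hmin S hsz (by omega) hpr fun W hW => ?_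
  have := pot_pos hmin W (hne.mono hW)
  omega

lemma xe_le_sq [DecidableEq V] (T : Finset V) : xe G T T ≤ T.card * ((T.card : ℤ) - 1) := by
  have : ∀ u ∈ T, ∑ v ∈ T, ad G u v ≤ (T.card : ℤ) - 1 := by
    intro u hu
    rw [← Finset.add_sum_erase _ _ hu, ad_zero G (G.loopless.irrefl u), zero_add]
    have h1 : ∑ v ∈ T.erase u, ad G u v ≤ ∑ v ∈ T.erase u, (1 : ℤ) :=
      Finset.sum_le_sum fun v _ => by unfold ad; split_ifs <;> simp
    rw [Finset.sum_const, Finset.card_erase_of_mem hu] at h1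
    have : 1 ≤ T.card := Finset.card_pos.2 ⟨u, hu⟩
    rw [nsmul_eq_mul, mul_one] at h1
    push_cast [this] at h1
    exact h1
  have h2 := Finset.sum_le_sum this
  rw [Finset.sum_const, nsmul_eq_mul] at h2
  exact h2

lemma step_two (hmin : IsMinCounterexample G I F U) (S : Finset V)
    (hsz : 10 ≤ 2 * (S.card : ℤ) + xe G S S) (hpr : S ≠ Finset.univ) : 6 ≤ pot G I F S := by
  classical
  have hne : S.Nonempty := by
    rcases S.eq_empty_or_nonempty with rfl | h
    · simp [xe] at hsz
    · exact h
  by_contra hlt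
  obtain ⟨k, hk⟩ := pot_even (G := G) hmin.1.1 S
  have h1 := step_one hmin S hsz hpr
  have hS : pot G I F S = 4 := by omega
  have hge : ∀ W : Finset V, S ⊆ W → W ≠ Finset.univ → 4 ≤ pot G I F W := by
    intro W hW hWu
    refine step_one hmin W ?_ hWu
    have a1 : xe G S S ≤ xe G W W := (xe_mono_left G hW).trans (xe_mono_right G hW)
    have a2 := Finset.card_le_card hW
    omega
  have hpu : pot G I F Finset.univ = 2 := by
    by_contra hpu
    obtain ⟨l, hl⟩ := pot_even (G := G) hmin.1.1 Finset.univ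
    have := pot_pos hmin Finset.univ (hne.mono (Finset.subset_univ S))
    refine case_a hmin S hsz hS.le hpr fun W hW => ?_
    by_cases hWu : W = Finset.univ
    · rw [hWu]; omega
    · rw [hS]; exact hge W hW hWu
  have hsplit := pot_union G I F (A := Sᶜ) (B := S) disjoint_compl_left
  rw [Finset.union_comm, Finset.union_compl, hpu, hS] at hsplit
  have hScne : Sᶜ.Nonempty := by
    rw [Finset.nonempty_iff_ne_empty]
    simpa using hpr
  have hpc := pot_pos hmin Sᶜ hScne
  obtain ⟨A, hA⟩ := sub_part hmin S hpr F hmin.1.1.2.1 fun T hT _ => by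
    have := pot_pos hmin T hT
    omega
  -- there is a boundary vertex
  have hb : ∃ w ∉ S, ∃ s ∈ S, G.Adj w s := by
    by_contra hb
    push Not at hb
    have := xe_eq_zero G (A := Sᶜ) (B := S) fun w hw s hs => hb w (by simpa using hw) s hs
    omega
  obtain ⟨w, hw, s, hs, hws⟩ := hb
  by_cases hall : ∀ s ∈ S, ∀ w ∉ S, G.Adj w s → s ∈ A
  swap
  · push Not at hall
    obtain ⟨s, hs, w, hw, hsw, hsA⟩ := hall
    exact case_b hmin S hsz hS hge A hA s w hs hw hsw hsA
  by_cases hone : ∃ w' ∉ S, ∃ s' ∈ S, G.Adj w' s' ∧ s' ≠ s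
  · obtain ⟨w', hw', s', hs', hsw', hne'⟩ := hone
    exact case_c hmin S hsz hS hne hge A hA hall s w s' w' hs hw hws hs' hw' hsw' hne'
  push Not at hone
  have hx : xe G Sᶜ S = xe G Sᶜ {s} := by
    have e : {s} ∪ S.erase s = S := by
      ext x; by_cases hx : x = s <;> simp [hx, hs]
    have e2 := xe_union_right G Sᶜ (A := {s}) (B := S.erase s) (by simp)
    rw [e] at e2
    rw [e2, xe_eq_zero G (B := S.erase s), add_zero]
    intro w hw s' hs' h
    have := hone w (by simpa using hw) s' (Finset.mem_of_mem_erase hs') h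
    exact (Finset.ne_of_mem_erase hs') this
  have hsF : s ∉ F := fun h => hA.2.1 s hs h (hall s hs w hw hws)
  have hsI : s ∉ I := by
    intro hsI
    have e := pot_union G I F (A := Sᶜ) (B := {s}) (by simpa using hs)
    have e2 := pot_pos hmin (Sᶜ ∪ {s}) (by simp)
    have e3 : pot G I F {s} = 2 := by
      simp [pot, wt, xe, hsI, ad]
    omega
  have hwt : ∀ v, wt I (insert s F) v = wt I F v - if s = v then 1 else 0 := by
    intro v
    by_cases hv : s = v
    · subst hv; simp [wt, hsI, hsF]
    · have : v ≠ s := fun h => hv h.symm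
      simp [wt, hv, this]
  obtain ⟨A', hA'⟩ := sub_part hmin S hpr (insert s F) (by
      rw [Set.disjoint_left]
      rintro x hxI (hxs | hxF)
      · exact hsI (hxs ▸ hxI)
      · exact Set.disjoint_left.1 hmin.1.1.2.1 hxI hxF) (by
    intro T hT hTS
    have hp : pot G I (insert s F) T = pot G I F T - if s ∈ T then 2 else 0 := by
      unfold pot
      simp only [hwt, Finset.sum_sub_distrib, Finset.sum_ite_eq]
      split_ifs <;> ring
    rw [hp]
    have p0 := pot_pos hmin T hT
    split_ifs with hsT
    swap
    · omega
    have hTu : T ≠ Finset.univ := by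
      rintro rfl
      exact hpr (Finset.univ_subset_iff.1 hTS)
    by_cases hbig : 10 ≤ 2 * (T.card : ℤ) + xe G T T
    · have := step_one hmin T hbig hTu
      omega
    · have w1 : (T.card : ℤ) + 4 ≤ ∑ v ∈ T, wt I F v := by
        rw [← Finset.add_sum_erase _ _ hsT]
        have b1 : wt I F s = 5 := by simp [wt, hsI, hsF]
        have b2 : ∑ v ∈ T.erase s, (1 : ℤ) ≤ ∑ v ∈ T.erase s, wt I F v :=
          Finset.sum_le_sum fun v _ => (wt_bounds I F v).1
        have b3 := Finset.card_erase_add_one hsT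
        simp only [Finset.sum_const, nsmul_eq_mul, mul_one] at b2
        omega
      have w2 := xe_le_sq (G := G) T
      have w3 := edgeCount_induce G T
      have w4 : 1 ≤ T.card := Finset.card_pos.2 hT
      have w5 : T.card ≤ 4 := by
        have := xe_nonneg G T T
        omega
      unfold pot
      generalize T.card = c at *
      interval_cases c <;> norm_num at * <;> omega)
  refine case_b hmin S hsz hS hge A' ⟨hA'.1, fun x hx hxF => hA'.2.1 x hx (Or.inr hxF), hA'.2.2.1,
    hA'.2.2.2⟩ s w hs hw hws (hA'.2.1 s hs (Or.inl rfl))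

end main

/-- Lemma 3.4: in a minimal counterexample, every proper subset `S` of the vertex set with
`|S| + |E(G[S])| ≥ 5` satisfies `ρ(S) ≥ 3`. -/
theorem potential_ge_three_of_large {V : Type*} [Fintype V] (G : SimpleGraph V)
    (I F U : Set V) (hmin : IsMinCounterexample G I F U)
    (S : Set V) (hproper : S ≠ Set.univ)
    (hsize : 5 ≤ S.ncard + edgeCount (G.induce S)) :
    3 ≤ rhoSet G I F U S := by
  classical
  have hT : S = (S.toFinset : Set V) := by simp
  rw [hT] at hsize hproper ⊢
  rw [Set.ncard_coe_finset] at hsize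
  have h1 := edgeCount_induce G S.toFinset
  have h2 := rhoSet_eq G I F U hmin.1.1 S.toFinset
  have h3 := step_two hmin S.toFinset (by omega) (by
    intro h
    apply hproper
    rw [h]; simp)
  omega
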